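/- arXiv:2504.10637 — 3 statements merged into one kernel-verified Lean document; each statement's English description precedes it below -/
import Mathlib

section
/- Let p, q be PMFs on a countable type A with equal supports, i.e., p(y) > 0 ↔ q(y) > 0 for all y. Define f(y) = log(p(y)/q(y)) and g(y) = q(y)/p(y) for y in the support (and f(y) = g(y) = 0 elsewhere). Assume KL(p‖q) < ∞ and KL(q‖p) < ∞, and that f, g, and f·g are p-integrable (the defining series converge absolutely). Then Cov_p[f,g] = −KL(p‖q) − KL(q‖p). Consequently, Cov_p[f,g] = 0 if and only if p = q. -/
open scoped BigOperators

/-- `pr p y` is the real-valued probability mass of `y` under the PMF `p`. -/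
noncomputable def pr {A : Type*} (p : PMF A) (y : A) : ℝ := (p y).toReal

/-- Expectation of `h` under the PMF `p`. -/
noncomputable def Epf {A : Type*} (p : PMF A) (h : A → ℝ) : ℝ := ∑' y, pr p y * h y

/-- Covariance of `h` and `k` under the PMF `p`. -/
noncomputable def Covp {A : Type*} (p : PMF A) (h k : A → ℝ) : ℝ :=
  Epf p (fun y => h y * k y) - Epf p h * Epf p k

/-- The KL divergence `KL(p‖q) = ∑_y p(y)·log(p(y)/q(y))`. -/
noncomputable def KLdiv {A : Type*} (p q : PMF A) : ℝ :=
  ∑' y, pr p y * Real.log (pr p y / pr q y)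

/-- The log-ratio `f(y) = log(p(y)/q(y))` on the support of `p`, and `0` elsewhere. -/
noncomputable def logRatio {A : Type*} (p q : PMF A) (y : A) : ℝ :=
  if 0 < pr p y then Real.log (pr p y / pr q y) else 0

/-- The likelihood ratio `g(y) = q(y)/p(y)` on the support of `p`, and `0` elsewhere. -/
noncomputable def likRatio {A : Type*} (p q : PMF A) (y : A) : ℝ :=
  if 0 < pr p y then pr q y / pr p y else 0

theorem pr_nonneg {A : Type*} (p : PMF A) (y : A) : 0 ≤ pr p y := ENNReal.toReal_nonneg

theorem tsum_pr {A : Type*} (p : PMF A) : ∑' y, pr p y = 1 := by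
  unfold pr
  rw [← ENNReal.tsum_toReal_eq p.apply_ne_top, p.tsum_coe, ENNReal.toReal_one]

theorem pr_injective {A : Type*} : Function.Injective (pr : PMF A → A → ℝ) := fun p q h =>
  PMF.ext fun y => (ENNReal.toReal_eq_toReal_iff' (p.apply_ne_top y) (q.apply_ne_top y)).1
    (congrFun h y)

theorem mul_log_div_add_mul_log_div {a b : ℝ} (ha : 0 < a) (hb : 0 < b) :
    a * Real.log (a / b) + b * Real.log (b / a) = (a - b) * (Real.log a - Real.log b) := by
  rw [Real.log_div ha.ne' hb.ne', Real.log_div hb.ne' ha.ne']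
  ring

theorem mul_log_div_add_mul_log_div_nonneg {a b : ℝ} (ha : 0 < a) (hb : 0 < b) :
    0 ≤ a * Real.log (a / b) + b * Real.log (b / a) := by
  rw [mul_log_div_add_mul_log_div ha hb]
  rcases le_total a b with h | h
  · exact mul_nonneg_of_nonpos_of_nonpos (sub_nonpos.2 h) (sub_nonpos.2 (Real.log_le_log ha h))
  · exact mul_nonneg (sub_nonneg.2 h) (sub_nonneg.2 (Real.log_le_log hb h))

theorem eq_of_mul_log_div_add_mul_log_div_eq_zero {a b : ℝ} (ha : 0 < a) (hb : 0 < b)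
    (h : a * Real.log (a / b) + b * Real.log (b / a) = 0) : a = b := by
  rw [mul_log_div_add_mul_log_div ha hb] at h
  rcases mul_eq_zero.1 h with h | h
  · exact sub_eq_zero.1 h
  · exact Real.log_injOn_pos ha hb (sub_eq_zero.1 h)

theorem KLdiv_self {A : Type*} (p : PMF A) : KLdiv p p = 0 := by
  simp [KLdiv]

/-- The symmetrized KL divergence of two PMFs with equal supports vanishes only if they agree. -/
theorem KLdiv_add_KLdiv_eq_zero_iff {A : Type*} (p q : PMF A)
    (hsupp : ∀ y, 0 < pr p y ↔ 0 < pr q y)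
    (hpq : Summable fun y => pr p y * Real.log (pr p y / pr q y))
    (hqp : Summable fun y => pr q y * Real.log (pr q y / pr p y)) :
    KLdiv p q + KLdiv q p = 0 ↔ p = q := by
  refine ⟨fun h => ?_, fun h => by simp [h, KLdiv_self]⟩
  have hzero (y : A) (hy : ¬0 < pr p y) : pr p y = 0 ∧ pr q y = 0 :=
    ⟨le_antisymm (not_lt.1 hy) (pr_nonneg p y),
      le_antisymm (not_lt.1 (mt (hsupp y).2 hy)) (pr_nonneg q y)⟩
  have hnonneg (y : A) :
      0 ≤ pr p y * Real.log (pr p y / pr q y) + pr q y * Real.log (pr q y / pr p y) := by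
    by_cases hy : 0 < pr p y
    · exact mul_log_div_add_mul_log_div_nonneg hy ((hsupp y).1 hy)
    · simp [hzero y hy]
  unfold KLdiv at h
  rw [← hpq.tsum_add hqp] at h
  have hall := (hasSum_zero_iff_of_nonneg hnonneg).1 (h ▸ (hpq.add hqp).hasSum)
  refine pr_injective (funext fun y => ?_)
  by_cases hy : 0 < pr p y
  · exact eq_of_mul_log_div_add_mul_log_div_eq_zero hy ((hsupp y).1 hy) (congrFun hall y)
  · rw [(hzero y hy).1, (hzero y hy).2]

theorem pr_mul_logRatio {A : Type*} (p q : PMF A) (y : A) :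
    pr p y * logRatio p q y = pr p y * Real.log (pr p y / pr q y) := by
  unfold logRatio
  split_ifs with hy
  · rfl
  · simp [le_antisymm (not_lt.1 hy) (pr_nonneg p y)]

theorem pr_mul_likRatio {A : Type*} (p q : PMF A) (y : A) (hy : 0 < pr q y → 0 < pr p y) :
    pr p y * likRatio p q y = pr q y := by
  unfold likRatio
  split_ifs with h
  · exact mul_div_cancel₀ _ h.ne'
  · rw [mul_zero, le_antisymm (not_lt.1 (mt hy h)) (pr_nonneg q y)]

theorem pr_mul_logRatio_mul_likRatio {A : Type*} (p q : PMF A) (y : A)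
    (hy : 0 < pr q y → 0 < pr p y) :
    pr p y * (logRatio p q y * likRatio p q y) =
      -(pr q y * Real.log (pr q y / pr p y)) := by
  rw [mul_left_comm, pr_mul_likRatio p q y hy]
  by_cases h : 0 < pr p y
  · rw [logRatio, if_pos h, ← inv_div, Real.log_inv]
    ring
  · simp [le_antisymm (not_lt.1 (mt hy h)) (pr_nonneg q y)]

/-- **Covariance of the control variate.**
Let `p, q` be PMFs on a countable type `A` with equal supports, `f(y) = log(p(y)/q(y))`,
`g(y) = q(y)/p(y)` (both set to `0` off the support of `p`).  Assume `KL(p‖q) < ∞`,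
`KL(q‖p) < ∞`, and that `f`, `g`, and `f·g` are `p`-integrable.  Then
`Cov_p[f,g] = -KL(p‖q) - KL(q‖p)`; consequently `Cov_p[f,g] = 0 ↔ p = q`. -/
theorem cov_logRatio_likRatio {A : Type*} [Countable A] (p q : PMF A)
    (hsupp : ∀ y, 0 < pr p y ↔ 0 < pr q y)
    (hKLpq : Summable fun y => pr p y * Real.log (pr p y / pr q y))
    (hKLqp : Summable fun y => pr q y * Real.log (pr q y / pr p y))
    (hf : Summable fun y => pr p y * logRatio p q y)
    (hg : Summable fun y => pr p y * likRatio p q y)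
    (hfgs : Summable fun y => pr p y * (logRatio p q y * likRatio p q y)) :
    Covp p (logRatio p q) (likRatio p q) = -KLdiv p q - KLdiv q p ∧
    (Covp p (logRatio p q) (likRatio p q) = 0 ↔ p = q) := by
  have hcov : Covp p (logRatio p q) (likRatio p q) = -KLdiv p q - KLdiv q p := by
    simp only [Covp, Epf, KLdiv, pr_mul_logRatio,
      fun y => pr_mul_logRatio_mul_likRatio p q y (hsupp y).2,
      fun y => pr_mul_likRatio p q y (hsupp y).2, tsum_neg, tsum_pr]
    ring
  refine ⟨hcov, ?_⟩
  rw [hcov, ← KLdiv_add_KLdiv_eq_zero_iff p q hsupp hKLpq hKLqp, ← neg_add', neg_eq_zero]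
end

section
/- Let A be a countable type, p a PMF on A, and f : A → ℝ with ∑_{y∈A} p(y)·|f(y)| < ∞. Let (Ω, 𝓕, μ) be a probability space and S : Ω → Finset A a random finite subset such that for every y ∈ A the event {ω | y ∈ S(ω)} is measurable, and such that the inclusion probability π(y) := μ{ω | y ∈ S(ω)} satisfies π(y) > 0 whenever p(y) > 0. Then the Horvitz–Thompson estimator ω ↦ ∑_{y ∈ S(ω)} (p(y)/π(y))·f(y) is μ-integrable and unbiased: ∫_Ω ∑_{y ∈ S(ω)} (p(y)/π(y))·f(y) dμ(ω) = ∑_{y∈A} p(y)·f(y). -/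
open scoped BigOperators
open MeasureTheory

/-- A pointwise sum of countably many real functions with summable `L¹` norms is integrable. -/
theorem integrable_tsum_of_summable_integral_norm {α ι : Type*} [Countable ι]
    {_ : MeasurableSpace α} {μ : Measure α} {F : ι → α → ℝ}
    (hF_int : ∀ i, Integrable (F i) μ) (hF_sum : Summable fun i => ∫ a, ‖F i a‖ ∂μ) :
    Integrable (fun a => ∑' i, F i a) μ := by
  refine ⟨(AEMeasurable.tsum fun i => (hF_int i).aemeasurable).aestronglyMeasurable, ?_⟩
  calc ∫⁻ a, ‖∑' i, F i a‖ₑ ∂μ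
      ≤ ∫⁻ a, ∑' i, ‖F i a‖ₑ ∂μ := lintegral_mono fun _ => enorm_tsum_le_tsum_enorm
    _ = ∑' i, ∫⁻ a, ‖F i a‖ₑ ∂μ := lintegral_tsum fun i => (hF_int i).1.enorm
    _ = ∑' i, ENNReal.ofReal (∫ a, ‖F i a‖ ∂μ) :=
        tsum_congr fun i => (ofReal_integral_norm_eq_lintegral_enorm (hF_int i)).symm
    _ < ⊤ := hF_sum.tsum_ofReal_lt_top

/-- **Unbiasedness of the Horvitz–Thompson estimator.**
Let `A` be countable, `p` a PMF on `A`, and `f : A → ℝ` with `∑_y p(y)·|f(y)| < ∞`.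
Let `(Ω, μ)` be a probability space and `S : Ω → Finset A` a random finite subset with
measurable inclusion events, and suppose the inclusion probability
`π(y) = μ {ω | y ∈ S ω}` is positive whenever `p(y) > 0`.  Then the Horvitz–Thompson
estimator `ω ↦ ∑_{y ∈ S ω} (p(y)/π(y))·f(y)` is `μ`-integrable and unbiased for
`∑_y p(y)·f(y)`. -/
theorem horvitz_thompson_unbiased {A : Type*} [Countable A]
    {Ω : Type*} [MeasurableSpace Ω] (μ : Measure Ω) [IsProbabilityMeasure μ]
    (p : PMF A) (f : A → ℝ) (S : Ω → Finset A)
    (hmeas : ∀ y : A, MeasurableSet {ω | y ∈ S ω})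
    (hf : Summable fun y => pr p y * |f y|)
    (hpos : ∀ y : A, 0 < pr p y → 0 < (μ {ω | y ∈ S ω}).toReal) :
    Integrable (fun ω => ∑ y ∈ S ω, (pr p y / (μ {ω' | y ∈ S ω'}).toReal) * f y) μ ∧
    (∫ ω, ∑ y ∈ S ω, (pr p y / (μ {ω' | y ∈ S ω'}).toReal) * f y ∂μ)
      = ∑' y, pr p y * f y := by
  set π : A → ℝ := fun y => (μ {ω | y ∈ S ω}).toReal
  set c : A → ℝ := fun y => pr p y / π y * f y
  set F : A → Ω → ℝ := fun y => {ω | y ∈ S ω}.indicator fun _ => c y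
  have hp (y : A) : 0 ≤ pr p y := ENNReal.toReal_nonneg
  have hcancel (y : A) : π y * (pr p y / π y) = pr p y := by
    rcases (hp y).eq_or_lt with h | h
    · simp [← h]
    · exact mul_div_cancel₀ _ (hpos y h).ne'
  have hsum (ω : Ω) : ∑ y ∈ S ω, c y = ∑' y, F y ω := by
    have hzero (y : A) (hy : y ∉ S ω) : F y ω = 0 :=
      Set.indicator_of_notMem (s := {ω | y ∈ S ω}) hy _
    rw [tsum_eq_sum hzero]
    exact Finset.sum_congr rfl fun y hy =>
      (Set.indicator_of_mem (s := {ω | y ∈ S ω}) hy fun _ => c y).symm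
  have hint (y : A) : Integrable (F y) μ := (integrable_const (c y)).indicator (hmeas y)
  have hF (y : A) : ∫ ω, F y ω ∂μ = pr p y * f y := by
    rw [integral_indicator_const _ (hmeas y), smul_eq_mul, ← mul_assoc]
    exact congrArg (· * f y) (hcancel y)
  have hnorm (y : A) : ∫ ω, ‖F y ω‖ ∂μ = pr p y * |f y| := by
    have hπ_nonneg : 0 ≤ π y := ENNReal.toReal_nonneg
    simp_rw [F, norm_indicator_eq_indicator_norm]
    rw [integral_indicator_const _ (hmeas y), smul_eq_mul, Real.norm_eq_abs, abs_mul,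
      abs_of_nonneg (div_nonneg (hp y) hπ_nonneg), ← mul_assoc]
    exact congrArg (· * |f y|) (hcancel y)
  have hnorm_sum : Summable fun y => ∫ ω, ‖F y ω‖ ∂μ := by simpa only [hnorm] using hf
  change Integrable (fun ω => ∑ y ∈ S ω, c y) μ ∧ ∫ ω, ∑ y ∈ S ω, c y ∂μ = _
  simp_rw [hsum]
  refine ⟨integrable_tsum_of_summable_integral_norm hint hnorm_sum, ?_⟩
  rw [← integral_tsum_of_summable_integral_norm hint hnorm_sum]
  exact tsum_congr hF
end

section
/- Let (p_θ)_{θ∈ℝ^d} be a family of language models over a finite alphabet Σ with p_θ(y) > 0 for all y ∈ Σ* and θ, let q be a fixed language model with q(y) > 0 for all y, and fix θ0 ∈ ℝ^d. For each prefix x ∈ Σ* define h_x(θ) = π_θ(x) · KL( p̄_θ(·|x) ‖ q̄(·|x) ). Assume: (a) for every prefix x, the map θ ↦ π_θ(x) is differentiable at θ0 (hence so is θ ↦ p̄_θ(a|x) for each a ∈ Σ̄); (b) each h_x is differentiable at θ0, the family of gradients (∇h_x(θ0))_{x∈Σ*} is summable in ℝ^d, and θ ↦ KL(p_θ‖q)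 is differentiable at θ0 with ∇KL(p_θ‖q)(θ0) = ∑_{x∈Σ*} ∇h_x(θ0). Then the gradient of the KL divergence satisfies ∇KL(p_θ‖q)(θ0) = ∑_{x∈Σ*} π_{θ0}(x) · ∑_{a∈Σ̄} p̄_{θ0}(a|x) · log( p̄_{θ0}(a|x)/q̄(a|x) ) · ( ∇log p̄_θ(a|x)(θ0) + ∇log π_θ(x)(θ0) ). -/
open scoped BigOperators

/-- Variance of `h` under the PMF `p`. -/
noncomputable def Varp {A : Type*} (p : PMF A) (h : A → ℝ) : ℝ :=
  Epf p (fun y => h y ^ 2) - (Epf p h) ^ 2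

/-- The prefix probability `π_p(x) = ∑_z p(x ++ z)` of a language model `p`. -/
noncomputable def prefixProb {σ : Type*} (p : PMF (List σ)) (x : List σ) : ℝ :=
  ∑' z : List σ, pr p (x ++ z)

/-- The conditional next-symbol distribution `p̄(·|x)` on `Σ̄ = Σ ∪ {EOS}`
(`Option σ`, with `none` playing the role of `EOS`):
`p̄(a|x) = π_p(x ++ [a]) / π_p(x)` for `a ∈ Σ` and `p̄(EOS|x) = p(x) / π_p(x)`. -/
noncomputable def condProb {σ : Type*} (p : PMF (List σ)) (x : List σ) : Option σ → ℝ
  | some a => prefixProb p (x ++ [a]) / prefixProb p x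
  | none => pr p x / prefixProb p x

/-- The local KL divergence at a prefix `x`:
`KL(p̄(·|x) ‖ q̄(·|x)) = ∑_{a ∈ Σ̄} p̄(a|x)·log(p̄(a|x)/q̄(a|x))`. -/
noncomputable def localKL {σ : Type*} [Fintype σ] (p q : PMF (List σ)) (x : List σ) : ℝ :=
  ∑ a : Option σ, condProb p x a * Real.log (condProb p x a / condProb q x a)

/-- `∇log F(θ0) := ∇F(θ0) / F(θ0)`, the gradient of the log of a positive function. -/
noncomputable def gradLog {F : Type*} [NormedAddCommGroup F] [InnerProductSpace ℝ F]
    [CompleteSpace F] (f : F → ℝ) (x : F) : F :=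
  (f x)⁻¹ • gradient f x

/-- The term of a KL divergence with reference weight `c`, as a function of the first weight,
has derivative `log (t / c) + 1`. -/
theorem hasDerivAt_mul_log_div {t c : ℝ} (ht : t ≠ 0) (hc : c ≠ 0) :
    HasDerivAt (fun s : ℝ => s * Real.log (s / c)) (Real.log (t / c) + 1) t := by
  have h := (hasDerivAt_id' t).fun_mul (((hasDerivAt_id' t).div_const c).log (div_ne_zero ht hc))
  refine h.congr_deriv ?_
  field_simp

/-- Product rule for a weight `g` times the divergence `∑ f i * log (f i / c i)` of functions
`f i` summing to `1`. -/
theorem hasGradientAt_mul_sum_mul_log_div {F ι : Type*} [NormedAddCommGroup F]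
    [InnerProductSpace ℝ F] [CompleteSpace F] [Fintype ι] {f : ι → F → ℝ} {g : F → ℝ}
    {c : ι → ℝ} {x : F} (hf : ∀ i, DifferentiableAt ℝ (f i) x) (hg : DifferentiableAt ℝ g x)
    (hf0 : ∀ i, f i x ≠ 0) (hg0 : g x ≠ 0) (hc : ∀ i, c i ≠ 0)
    (hsum : ∀ y, ∑ i, f i y = 1) :
    HasGradientAt (fun y => g y * ∑ i, f i y * Real.log (f i y / c i))
      (g x • ∑ i, (f i x * Real.log (f i x / c i)) • (gradLog (f i) x + gradLog g x)) x := by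
  have hzero : ∑ i, gradient (f i) x = 0 := by
    have h : HasFDerivAt (fun y => ∑ i, f i y)
        (∑ i, InnerProductSpace.toDual ℝ F (gradient (f i) x)) x :=
      HasFDerivAt.fun_sum fun i _ => (hf i).hasGradientAt.hasFDerivAt
    simp only [hsum] at h
    have h0 := h.unique (hasFDerivAt_const (1 : ℝ) x)
    rwa [← map_sum, LinearIsometryEquiv.map_eq_zero_iff] at h0
  have hterm (i : ι) : HasFDerivAt (fun y => f i y * Real.log (f i y / c i))
      ((Real.log (f i x / c i) + 1) • InnerProductSpace.toDual ℝ F (gradient (f i) x)) x :=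
    (hasDerivAt_mul_log_div (hf0 i) (hc i)).comp_hasFDerivAt x (hf i).hasGradientAt.hasFDerivAt
  have h := hg.hasGradientAt.hasFDerivAt.fun_mul
    (HasFDerivAt.fun_sum fun i (_ : i ∈ Finset.univ) => hterm i)
  have key : g x • ∑ i, (f i x * Real.log (f i x / c i)) • (gradLog (f i) x + gradLog g x)
      = g x • ∑ i, (Real.log (f i x / c i) + 1) • gradient (f i) x
        + (∑ i, f i x * Real.log (f i x / c i)) • gradient g x := by
    simp only [add_smul, one_smul, Finset.sum_add_distrib, hzero, add_zero, Finset.sum_smul,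
      Finset.smul_sum]
    rw [← Finset.sum_add_distrib]
    refine Finset.sum_congr rfl fun i _ => ?_
    simp only [gradLog, smul_add, smul_smul]
    have := hf0 i
    congr 2 <;> field_simp
  rw [hasGradientAt_iff_hasFDerivAt, key]
  refine h.congr_fderiv ?_
  simp only [map_add, map_smulₛₗ, map_sum, conj_trivial]

theorem summable_pr {A : Type*} (p : PMF A) : Summable (pr p) :=
  ENNReal.summable_toReal p.tsum_coe_ne_top

theorem summable_pr_append {σ : Type*} (p : PMF (List σ)) (x : List σ) :
    Summable fun z => pr p (x ++ z) :=
  (summable_pr p).comp_injective (List.append_right_injective x)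

theorem prefixProb_pos {σ : Type*} {p : PMF (List σ)} (hp : ∀ y, 0 < pr p y) (x : List σ) :
    0 < prefixProb p x :=
  (summable_pr_append p x).tsum_pos (fun _ => (hp _).le) [] (hp _)

theorem prefixProb_eq_add_sum {σ : Type*} [Fintype σ] (p : PMF (List σ)) (x : List σ) :
    prefixProb p x = pr p x + ∑ a, prefixProb p (x ++ [a]) := by
  let e : Unit ⊕ σ × List σ ≃ List σ :=
    { toFun := Sum.elim (fun _ => []) fun b => b.1 :: b.2
      invFun := fun l => l.casesOn (Sum.inl ()) fun a z => Sum.inr (a, z)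
      left_inv := by rintro (_ | ⟨a, z⟩) <;> rfl
      right_inv := by rintro (_ | ⟨a, z⟩) <;> rfl }
  have hs : Summable fun b : σ × List σ => pr p (x ++ b.1 :: b.2) :=
    (summable_pr_append p x).comp_injective (i := fun b : σ × List σ => b.1 :: b.2)
      (e.injective.comp Sum.inr_injective)
  have hprod : ∑' b : σ × List σ, pr p (x ++ b.1 :: b.2) = ∑ a, prefixProb p (x ++ [a]) := by
    rw [hs.tsum_prod, tsum_fintype]
    simp only [prefixProb, List.append_assoc, List.singleton_append]
  have hnil : HasSum (fun _ : Unit => pr p (x ++ [])) (pr p x) := by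
    simp
  have h : HasSum ((fun z => pr p (x ++ z)) ∘ e) (pr p x + ∑ a, prefixProb p (x ++ [a])) :=
    HasSum.sum hnil (hprod ▸ hs.hasSum)
  exact (e.hasSum_iff.mp h).tsum_eq

theorem condProb_pos {σ : Type*} {p : PMF (List σ)} (hp : ∀ y, 0 < pr p y) (x : List σ)
    (a : Option σ) : 0 < condProb p x a := by
  cases a with
  | none => exact div_pos (hp x) (prefixProb_pos hp x)
  | some a => exact div_pos (prefixProb_pos hp _) (prefixProb_pos hp x)

theorem sum_condProb {σ : Type*} [Fintype σ] {p : PMF (List σ)} {x : List σ}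
    (hx : prefixProb p x ≠ 0) : ∑ a, condProb p x a = 1 := by
  simp only [Fintype.sum_option, condProb]
  rw [← Finset.sum_div, ← add_div, ← prefixProb_eq_add_sum, div_self hx]

theorem differentiableAt_condProb {σ F : Type*} [Fintype σ] [NormedAddCommGroup F]
    [NormedSpace ℝ F] {P : F → PMF (List σ)} {θ : F}
    (hπ : ∀ x, DifferentiableAt ℝ (fun θ => prefixProb (P θ) x) θ) {x : List σ}
    (hx : prefixProb (P θ) x ≠ 0) (a : Option σ) :
    DifferentiableAt ℝ (fun θ => condProb (P θ) x a) θ := by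
  cases a with
  | some a => exact (hπ _).fun_mul ((hπ x).fun_inv hx)
  | none =>
    have hpr : (fun θ => pr (P θ) x)
        = fun θ => prefixProb (P θ) x - ∑ a, prefixProb (P θ) (x ++ [a]) :=
      funext fun θ => eq_sub_of_add_eq (prefixProb_eq_add_sum (P θ) x).symm
    have hd : DifferentiableAt ℝ (fun θ => pr (P θ) x) θ := by
      rw [hpr]
      exact (hπ x).fun_sub (DifferentiableAt.fun_sum fun a _ => hπ _)
    exact hd.fun_mul ((hπ x).fun_inv hx)

/-- **Rao–Blackwellized form of the gradient of the KL divergence**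
(Theorem 3 of the paper).  Let `(p_θ)` be a family of everywhere-positive language models
over a finite alphabet `Σ`, `q` an everywhere-positive language model, and `θ0 ∈ ℝ^d`.
Assume (a) each prefix probability `θ ↦ π_θ(x)` is differentiable at `θ0`; (b) each
`h_x(θ) = π_θ(x)·KL(p̄_θ(·|x)‖q̄(·|x))` is differentiable at `θ0`, and the family of
gradients `(∇h_x(θ0))_x` sums to `∇KL(p_θ‖q)(θ0)` (with `θ ↦ KL(p_θ‖q)` differentiable
at `θ0`).  Then
`∇KL(p_θ‖q)(θ0) = ∑_x π_{θ0}(x) · ∑_{a∈Σ̄} p̄_{θ0}(a|x)·log(p̄_{θ0}(a|x)/q̄(a|x)) ·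
  (∇log p̄_θ(a|x)(θ0) + ∇log π_θ(x)(θ0))`. -/
theorem kl_gradient_rao_blackwellized {σ : Type*} [Fintype σ] [Nonempty σ] {d : ℕ}
    (P : EuclideanSpace ℝ (Fin d) → PMF (List σ)) (q : PMF (List σ))
    (hp : ∀ θ y, 0 < pr (P θ) y) (hq : ∀ y, 0 < pr q y)
    (θ0 : EuclideanSpace ℝ (Fin d))
    (hπdiff : ∀ x : List σ, DifferentiableAt ℝ (fun θ => prefixProb (P θ) x) θ0)
    (hhdiff : ∀ x : List σ,
      DifferentiableAt ℝ (fun θ => prefixProb (P θ) x * localKL (P θ) q x) θ0)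
    (hKLdiff : DifferentiableAt ℝ (fun θ => KLdiv (P θ) q) θ0)
    (hsum : HasSum
      (fun x : List σ =>
        gradient (fun θ => prefixProb (P θ) x * localKL (P θ) q x) θ0)
      (gradient (fun θ => KLdiv (P θ) q) θ0)) :
    gradient (fun θ => KLdiv (P θ) q) θ0
      = ∑' x : List σ,
          prefixProb (P θ0) x •
            ∑ a : Option σ,
              (condProb (P θ0) x a *
                  Real.log (condProb (P θ0) x a / condProb q x a)) •
                (gradLog (fun θ => condProb (P θ) x a) θ0 +
                  gradLog (fun θ => prefixProb (P θ) x) θ0) := by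
  rw [← hsum.tsum_eq]
  refine tsum_congr fun x => ?_
  exact (hasGradientAt_mul_sum_mul_log_div
    (differentiableAt_condProb hπdiff (prefixProb_pos (hp θ0) x).ne') (hπdiff x)
    (fun a => (condProb_pos (hp θ0) x a).ne') (prefixProb_pos (hp θ0) x).ne'
    (fun a => (condProb_pos hq x a).ne')
    (fun θ => sum_condProb (prefixProb_pos (hp θ) x).ne')).gradient
end
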